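/- arXiv:2208.13532 — 2 statements merged into one kernel-verified Lean document; each statement's English description precedes it below -/
import Mathlib

section
/- Let n, μ, h_c > 0 with μ ≤ n, h_c ≥ √(μn), and let 0 ≤ σ² ≤ μ(√(μn) − μ). Then the supremum over all P in 𝒫(μ,σ²) of E[ min(X₁X₂/(μn),1)·min(X₁X₃/(μn),1)·min(X₂X₃/(μn),1) ], where X₁, X₂, X₃ are i.i.d. with law P, equals (μ²+σ²)³/(μn)³, and the supremum is attained by the three-point distribution with mass σ²/(√(μn)·μ) at 0, mass σ²/(√(μn)(√(μn)−μ)) at √(μn), and the remaining mass at μ. -/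
open MeasureTheory

lemma integrable_sq_of_ae_mem_Icc {P : Measure ℝ} [IsFiniteMeasure P] {h : ℝ}
    (hP : ∀ᵐ x ∂P, x ∈ Set.Icc 0 h) : Integrable (fun x : ℝ => x ^ 2) P := by
  refine Integrable.of_bound (by fun_prop) (h ^ 2) ?_
  filter_upwards [hP] with x hx
  rw [Real.norm_of_nonneg (sq_nonneg x)]
  exact pow_le_pow_left₀ hx.1 hx.2 2

/-- The triple integral of the product of squares factorizes. -/
lemma integral_sq_mul_sq_mul_sq (P : Measure ℝ) (c : ℝ) :
    (∫ x, ∫ y, ∫ z, x ^ 2 * (y ^ 2 * (z ^ 2 / c)) ∂P ∂P ∂P) = (∫ x, x ^ 2 ∂P) ^ 3 / c := by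
  simp only [integral_const_mul, integral_mul_const, integral_div]
  ring

/-- The triangle probability is at most its value for the untruncated kernel `x * y / c`. -/
lemma integral_triangle_le {P : Measure ℝ} [IsFiniteMeasure P] {h c : ℝ} (hc : 0 < c)
    (hP : ∀ᵐ x ∂P, x ∈ Set.Icc 0 h) :
    (∫ x, ∫ y, ∫ z, min (x * y / c) 1 * min (x * z / c) 1 * min (y * z / c) 1 ∂P ∂P ∂P)
      ≤ (∫ x, x ^ 2 ∂P) ^ 3 / c ^ 3 := by
  have hi := integrable_sq_of_ae_mem_Icc hP
  have hmin : ∀ {x y : ℝ}, 0 ≤ x → 0 ≤ y → 0 ≤ min (x * y / c) 1 := fun hx hy =>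
    le_min (by positivity) zero_le_one
  have hnn : ∀ {x y z : ℝ}, 0 ≤ x → 0 ≤ y → 0 ≤ z →
      0 ≤ min (x * y / c) 1 * min (x * z / c) 1 * min (y * z / c) 1 := fun hx hy hz =>
    mul_nonneg (mul_nonneg (hmin hx hy) (hmin hx hz)) (hmin hy hz)
  rw [← integral_sq_mul_sq_mul_sq]
  refine integral_mono_of_nonneg ?_ ?_ ?_
  · filter_upwards [hP] with x hx
    refine integral_nonneg_of_ae ?_
    filter_upwards [hP] with y hy
    refine integral_nonneg_of_ae ?_
    filter_upwards [hP] with z hz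
    exact hnn hx.1 hy.1 hz.1
  · simp only [integral_const_mul]
    exact hi.mul_const _
  filter_upwards [hP] with x hx
  refine integral_mono_of_nonneg ?_ ?_ ?_
  · filter_upwards [hP] with y hy
    refine integral_nonneg_of_ae ?_
    filter_upwards [hP] with z hz
    exact hnn hx.1 hy.1 hz.1
  · simp only [integral_const_mul]
    exact (hi.mul_const _).const_mul _
  filter_upwards [hP] with y hy
  refine integral_mono_of_nonneg ?_ ?_ ?_
  · filter_upwards [hP] with z hz
    exact hnn hx.1 hy.1 hz.1
  · exact ((hi.div_const _).const_mul _).const_mul _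
  filter_upwards [hP] with z hz
  calc min (x * y / c) 1 * min (x * z / c) 1 * min (y * z / c) 1
      ≤ (x * y / c) * (x * z / c) * (y * z / c) := by
        have hx0 := hx.1
        have hy0 := hy.1
        have hz0 := hz.1
        have := hmin hx0 hz0
        have := hmin hy0 hz0
        gcongr <;> exact min_le_left _ _
    _ = x ^ 2 * (y ^ 2 * (z ^ 2 / c ^ 3)) := by ring

/-- Truncation plays no role for laws supported on `[0, s]` with `s ^ 2 = c`. -/
lemma integral_triangle_eq {P : Measure ℝ} {s c : ℝ} (hc : 0 < c) (hsc : s ^ 2 = c)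
    (hP : ∀ᵐ x ∂P, x ∈ Set.Icc 0 s) :
    (∫ x, ∫ y, ∫ z, min (x * y / c) 1 * min (x * z / c) 1 * min (y * z / c) 1 ∂P ∂P ∂P)
      = (∫ x, x ^ 2 ∂P) ^ 3 / c ^ 3 := by
  have hmin : ∀ {x y : ℝ}, x ∈ Set.Icc 0 s → y ∈ Set.Icc 0 s → min (x * y / c) 1 = x * y / c := by
    intro x y hx hy
    refine min_eq_left ((div_le_one hc).2 ?_)
    rw [← hsc, sq]
    exact mul_le_mul hx.2 hy.2 hy.1 (hx.1.trans hx.2)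
  rw [← integral_sq_mul_sq_mul_sq]
  refine integral_congr_ae ?_
  filter_upwards [hP] with x hx
  refine integral_congr_ae ?_
  filter_upwards [hP] with y hy
  refine integral_congr_ae ?_
  filter_upwards [hP] with z hz
  rw [hmin hx hy, hmin hx hz, hmin hy hz]
  ring

lemma integral_three_dirac {a b d : ℝ} (ha : 0 ≤ a) (hb : 0 ≤ b) (hd : 0 ≤ d) (x y z : ℝ)
    (f : ℝ → ℝ) :
    ∫ t, f t ∂(ENNReal.ofReal a • Measure.dirac x + ENNReal.ofReal b • Measure.dirac y
      + ENNReal.ofReal d • Measure.dirac z) = a * f x + b * f y + d * f z := by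
  have hi : ∀ r u : ℝ, Integrable f (ENNReal.ofReal r • Measure.dirac u) := fun r u =>
    (integrable_dirac (by simp)).smul_measure ENNReal.ofReal_ne_top
  rw [integral_add_measure ((hi _ _).add_measure (hi _ _)) (hi _ _),
    integral_add_measure (hi _ _) (hi _ _)]
  simp [integral_smul_measure, ha, hb, hd]

/-- With `h_c ≥ √(μn)` and `0 ≤ σ² ≤ μ(√(μn) − μ)`, the supremum over
all probability measures `P` on `[0, h_c]` with mean `μ` and second moment `μ² + σ²`
of the triangle probability `E[min(X₁X₂/(μn),1) min(X₁X₃/(μn),1) min(X₂X₃/(μn),1)]`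
(with `X₁, X₂, X₃` i.i.d. with law `P`) equals `(μ²+σ²)³/(μn)³`, attained by the
three-point distribution with mass `σ²/(√(μn)μ)` at `0`, mass
`σ²/(√(μn)(√(μn)−μ))` at `√(μn)` and the remaining mass at `μ`. -/
theorem robust_triangle_sup
    (n μ h_c σ2 : ℝ) (hn : 0 < n) (hμ : 0 < μ) (hμn : μ ≤ n)
    (hhc : Real.sqrt (μ * n) ≤ h_c)
    (hσ2 : 0 ≤ σ2) (hσ2ub : σ2 ≤ μ * (Real.sqrt (μ * n) - μ)) :
    (∀ P : Measure ℝ, IsProbabilityMeasure P → P (Set.Icc 0 h_c)ᶜ = 0 →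
        (∫ x, x ∂P) = μ → (∫ x, x ^ 2 ∂P) = μ ^ 2 + σ2 →
        (∫ x, ∫ y, ∫ z, min (x * y / (μ * n)) 1 * min (x * z / (μ * n)) 1 *
            min (y * z / (μ * n)) 1 ∂P ∂P ∂P)
          ≤ (μ ^ 2 + σ2) ^ 3 / (μ * n) ^ 3) ∧
    (∀ P : Measure ℝ,
      P = ENNReal.ofReal (σ2 / (Real.sqrt (μ * n) * μ)) • Measure.dirac (0 : ℝ)
          + ENNReal.ofReal (σ2 / (Real.sqrt (μ * n) * (Real.sqrt (μ * n) - μ))) •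
              Measure.dirac (Real.sqrt (μ * n))
          + ENNReal.ofReal (1 - σ2 / (Real.sqrt (μ * n) * μ)
              - σ2 / (Real.sqrt (μ * n) * (Real.sqrt (μ * n) - μ))) • Measure.dirac μ →
      IsProbabilityMeasure P ∧ P (Set.Icc 0 h_c)ᶜ = 0 ∧
      (∫ x, x ∂P) = μ ∧ (∫ x, x ^ 2 ∂P) = μ ^ 2 + σ2 ∧
      (∫ x, ∫ y, ∫ z, min (x * y / (μ * n)) 1 * min (x * z / (μ * n)) 1 *
          min (y * z / (μ * n)) 1 ∂P ∂P ∂P)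
        = (μ ^ 2 + σ2) ^ 3 / (μ * n) ^ 3) := by
  set s := Real.sqrt (μ * n) with hs
  have hc : 0 < μ * n := mul_pos hμ hn
  have hsc : s ^ 2 = μ * n := Real.sq_sqrt hc.le
  have hspos : 0 < s := Real.sqrt_pos.2 hc
  have hμs : μ ≤ s := Real.le_sqrt_of_sq_le (by nlinarith)
  refine ⟨fun P _ hP _ h2 => ?_, fun P hPdef => ?_⟩
  · rw [← h2]
    exact integral_triangle_le hc (mem_ae_iff.2 hP)
  have hp0 : 0 ≤ σ2 / (s * μ) := by positivity
  have hp1 : 0 ≤ σ2 / (s * (s - μ)) := div_nonneg hσ2 (mul_nonneg hspos.le (sub_nonneg.2 hμs))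
  have hgap : σ2 / (s * (s - μ)) * (s - μ) = σ2 / s := by
    rcases hμs.eq_or_lt with h | h
    · have : σ2 = 0 := le_antisymm (by simpa [← h] using hσ2ub) hσ2
      simp [this]
    · have : s - μ ≠ 0 := (sub_pos.2 h).ne'
      field_simp
  have hzero : σ2 / (s * μ) * μ = σ2 / s := by field_simp
  have hp2 : 0 ≤ 1 - σ2 / (s * μ) - σ2 / (s * (s - μ)) := by
    rcases hμs.eq_or_lt with h | h
    · have : σ2 = 0 := le_antisymm (by simpa [← h] using hσ2ub) hσ2
      simp [this]
    · have h' : 0 < s - μ := sub_pos.2 h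
      have : 1 - σ2 / (s * μ) - σ2 / (s * (s - μ)) = 1 - σ2 / (μ * (s - μ)) := by
        field_simp
        ring
      rw [this, sub_nonneg]
      exact div_le_one_of_le₀ hσ2ub (by positivity)
  have hint := integral_three_dirac hp0 hp1 hp2 0 s μ
  rw [← hPdef] at hint
  have hprob : IsProbabilityMeasure P := by
    constructor
    simp only [hPdef, Measure.add_apply, Measure.smul_apply, measure_univ, smul_eq_mul, mul_one]
    rw [← ENNReal.ofReal_add hp0 hp1, ← ENNReal.ofReal_add (add_nonneg hp0 hp1) hp2]
    simp
  have hsupp : ∀ t, s ≤ t → P (Set.Icc 0 t)ᶜ = 0 := by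
    intro t ht
    simp [hPdef, hspos.le, hμ.le, ht, hμs.trans ht, hspos.le.trans ht]
  have hsq : s * (σ2 / s) = σ2 := by field_simp
  have h2 : (∫ x, x ^ 2 ∂P) = μ ^ 2 + σ2 := by
    rw [hint fun x => x ^ 2]
    linear_combination (s + μ) * hgap - μ * hzero + hsq
  refine ⟨hprob, hsupp h_c hhc, ?_, h2, ?_⟩
  · rw [hint fun x => x]
    linear_combination hgap - hzero
  · rw [integral_triangle_eq hc hsc (mem_ae_iff.2 (hsupp s le_rfl)), h2]
end

section
/- Let n, μ, h_c > 0, let h, h₂ ∈ (0, n], set l = μn/max(h, h₂), and assume μ < l ≤ h_c, d ≥ 0, and d/(2μ) + d/(2(l−μ)) ≤ 1. Then the supremum of ∫ min(hx/(μn), 1)·min(h₂x/(μn), 1) dP(x) over all probability measures P in 𝒫(μ,d) equals h·h₂/n² + d·min(h, h₂)/(2μn), and the supremum is attained by the three-point distribution placing mass d/(2μ) at 0, mass d/(2(l−μ)) at l, and the remaining mass at μ. -/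
open MeasureTheory

/-- The product of truncated linear functions lies below the piecewise linear function
interpolating it at `0`, `1` and `α⁻¹`. -/
lemma min_mul_min_le_piecewise_linear {α β t : ℝ} (hα : 0 < α) (hβ : 0 < β)
    (ht : 0 ≤ t) :
    min (α * t) 1 * min (β * t) 1
      ≤ α * β + (2 * α + 1) * β / 2 * (t - 1) + β / 2 * |t - 1| := by
  have hβt : 0 ≤ β * t := by positivity
  have hb : 0 ≤ min (β * t) 1 := le_min hβt zero_le_one
  have hquad : min (α * t) 1 * min (β * t) 1 ≤ α * t * (β * t) :=
    mul_le_mul (min_le_left _ _) (min_le_left _ _) hb (by positivity)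
  have hlin : min (α * t) 1 * min (β * t) 1 ≤ 1 * (β * t) :=
    mul_le_mul (min_le_right _ _) (min_le_left _ _) hb zero_le_one
  rcases le_total t 1 with h | h
  · rw [abs_of_nonpos (by linarith)]
    have : 0 ≤ α * β * (t * (1 - t)) :=
      mul_nonneg (by positivity) (mul_nonneg ht (by linarith))
    nlinarith
  · rw [abs_of_nonneg (by linarith)]
    rcases le_total (α * t) 1 with hc | hc
    · have : 0 ≤ β * ((t - 1) * (1 - α * t)) :=
        mul_nonneg hβ.le (mul_nonneg (by linarith) (by linarith))
      nlinarith
    · have : 0 ≤ β * (α * t - 1) := mul_nonneg hβ.le (by linarith)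
      nlinarith

/-- Exchanging the two weights replaces them by their maximum and minimum. -/
lemma min_mul_min_eq_max_min (h h2 : ℝ) (x c : ℝ) :
    min (h * x / c) 1 * min (h2 * x / c) 1
      = min (max h h2 * x / c) 1 * min (min h h2 * x / c) 1 := by
  rcases le_total h h2 with hle | hle
  · rw [max_eq_right hle, min_eq_left hle, mul_comm]
  · rw [max_eq_left hle, min_eq_right hle]

/-- Every function is integrable against a sum of three point masses, with the obvious
integral. -/
lemma integral_three_dirac_s17 {p q r : ℝ} (hp : 0 ≤ p) (hq : 0 ≤ q) (hr : 0 ≤ r)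
    (a b c : ℝ) (f : ℝ → ℝ) :
    ∫ x, f x ∂(ENNReal.ofReal p • Measure.dirac a + ENNReal.ofReal q • Measure.dirac b
      + ENNReal.ofReal r • Measure.dirac c) = p * f a + q * f b + r * f c := by
  have hint (w y : ℝ) : Integrable f (ENNReal.ofReal w • Measure.dirac y) :=
    (integrable_dirac (by simp)).smul_measure ENNReal.ofReal_ne_top
  rw [integral_add_measure ((hint _ _).add_measure (hint _ _)) (hint _ _),
    integral_add_measure (hint _ _) (hint _ _)]
  simp [ENNReal.toReal_ofReal, hp, hq, hr]

/-- With `l = μn/max(h, h₂)`, `μ < l ≤ h_c` and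
`d/(2μ) + d/(2(l−μ)) ≤ 1`, the supremum of
`∫ min(hx/(μn), 1) min(h₂x/(μn), 1) dP(x)` over all probability measures `P` on
`[0, h_c]` with mean `μ` and mean absolute deviation `d` equals
`h h₂/n² + d min(h, h₂)/(2μn)`, attained by the three-point distribution with mass
`d/(2μ)` at `0`, mass `d/(2(l−μ))` at `l` and the remaining mass at `μ`. -/
theorem robust_two_neighbor_sup_mad
    (n μ h_c h h2 l d : ℝ) (hn : 0 < n) (hμ : 0 < μ) (hhc : 0 < h_c)
    (hh : 0 < h) (hhn : h ≤ n) (hh2 : 0 < h2) (hh2n : h2 ≤ n)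
    (hl : l = μ * n / max h h2) (hμl : μ < l) (hlhc : l ≤ h_c) (hd : 0 ≤ d)
    (hdub : d / (2 * μ) + d / (2 * (l - μ)) ≤ 1) :
    (∀ P : Measure ℝ, IsProbabilityMeasure P → P (Set.Icc 0 h_c)ᶜ = 0 →
        (∫ x, x ∂P) = μ → (∫ x, |x - μ| ∂P) = d →
        (∫ x, min (h * x / (μ * n)) 1 * min (h2 * x / (μ * n)) 1 ∂P)
          ≤ h * h2 / n ^ 2 + d * min h h2 / (2 * μ * n)) ∧
    (∀ P : Measure ℝ,
      P = ENNReal.ofReal (d / (2 * μ)) • Measure.dirac (0 : ℝ)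
          + ENNReal.ofReal (d / (2 * (l - μ))) • Measure.dirac l
          + ENNReal.ofReal (1 - d / (2 * μ) - d / (2 * (l - μ))) • Measure.dirac μ →
      IsProbabilityMeasure P ∧ P (Set.Icc 0 h_c)ᶜ = 0 ∧
      (∫ x, x ∂P) = μ ∧ (∫ x, |x - μ| ∂P) = d ∧
      (∫ x, min (h * x / (μ * n)) 1 * min (h2 * x / (μ * n)) 1 ∂P)
        = h * h2 / n ^ 2 + d * min h h2 / (2 * μ * n)) := by
  have hprod : h * h2 = max h h2 * min h h2 := (max_mul_min h h2).symm
  simp only [min_mul_min_eq_max_min h h2, hprod]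
  have hMn : max h h2 ≤ n := max_le hhn hh2n
  have hM : 0 < max h h2 := lt_max_of_lt_left hh
  have hm : 0 < min h h2 := lt_min hh hh2
  have hmM : min h h2 ≤ max h h2 := min_le_max
  generalize max h h2 = M at *
  generalize min h h2 = m at *
  constructor
  · intro P hP hsupp hmean hmad
    have hae : ∀ᵐ x ∂P, x ∈ Set.Icc 0 h_c := hsupp
    have hid : Integrable (fun x : ℝ => x) P := by
      refine Integrable.of_bound (by fun_prop) h_c ?_
      filter_upwards [hae] with x hx
      rw [Real.norm_of_nonneg hx.1]
      exact hx.2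
    have hsub : Integrable (fun x : ℝ => x - μ) P := hid.sub (integrable_const μ)
    have habs : Integrable (fun x : ℝ => |x - μ|) P := hsub.abs
    set a : ℝ := M * m / n ^ 2
    set b : ℝ := (2 * (M / n) + 1) * (m / n) / 2 / μ
    set c : ℝ := m / n / 2 / μ
    have hle : (fun x => min (M * x / (μ * n)) 1 * min (m * x / (μ * n)) 1)
        ≤ᵐ[P] fun x => a + b * (x - μ) + c * |x - μ| := by
      filter_upwards [hae] with x hx
      have key := min_mul_min_le_piecewise_linear (div_pos hM hn) (div_pos hm hn)
        (div_nonneg hx.1 hμ.le)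
      have habs_div : |x / μ - 1| = |x - μ| / μ := by
        rw [show x / μ - 1 = (x - μ) / μ by field_simp, abs_div, abs_of_pos hμ]
      rw [habs_div] at key
      calc min (M * x / (μ * n)) 1 * min (m * x / (μ * n)) 1
          = min (M / n * (x / μ)) 1 * min (m / n * (x / μ)) 1 := by
            congr 2 <;> field_simp
        _ ≤ _ := key
        _ = a + b * (x - μ) + c * |x - μ| := by
            simp only [a, b, c]
            field_simp
    have hab : Integrable (fun x => a + b * (x - μ)) P :=
      (integrable_const a).add (hsub.const_mul b)
    calc ∫ x, min (M * x / (μ * n)) 1 * min (m * x / (μ * n)) 1 ∂P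
        ≤ ∫ x, (a + b * (x - μ) + c * |x - μ|) ∂P := by
          refine integral_mono_of_nonneg ?_ (hab.add (habs.const_mul c)) hle
          filter_upwards [hae] with x hx
          have := hx.1
          exact mul_nonneg (le_min (by positivity) zero_le_one)
            (le_min (by positivity) zero_le_one)
      _ = a + c * d := by
          rw [integral_add hab (habs.const_mul c),
            integral_add (integrable_const a) (hsub.const_mul b), integral_const_mul,
            integral_const_mul, integral_sub hid (integrable_const μ), hmean, hmad]
          simp
      _ = M * m / n ^ 2 + d * m / (2 * μ * n) := by
          simp only [a, c]
          field_simp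
  · rintro P rfl
    have hlμ : 0 < l - μ := sub_pos.mpr hμl
    have hp : 0 ≤ d / (2 * μ) := by positivity
    have hq : 0 ≤ d / (2 * (l - μ)) := by positivity
    have hr : 0 ≤ 1 - d / (2 * μ) - d / (2 * (l - μ)) := by linarith
    have hMl : M * l = μ * n := by rw [hl]; field_simp
    refine ⟨⟨?_⟩, ?_, ?_, ?_, ?_⟩
    · simp only [Measure.add_apply, Measure.smul_apply, measure_univ, smul_eq_mul, mul_one]
      rw [← ENNReal.ofReal_add hp hq, ← ENNReal.ofReal_add (by positivity) hr,
        show d / (2 * μ) + d / (2 * (l - μ)) + (1 - d / (2 * μ) - d / (2 * (l - μ))) = 1 by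
          ring, ENNReal.ofReal_one]
    · have hl0 : 0 ≤ l := by linarith
      have hμc : μ ≤ h_c := by linarith
      simp [hhc.le, hl0, hlhc, hμ.le, hμc]
    · rw [integral_three_dirac_s17 hp hq hr]
      field_simp
      ring
    · rw [integral_three_dirac_s17 hp hq hr, abs_of_pos hlμ, zero_sub, abs_neg,
        abs_of_pos hμ, sub_self, abs_zero]
      field_simp
      ring
    · rw [integral_three_dirac_s17 hp hq hr]
      have hMlt : M < n := by nlinarith
      have hnM : 0 < n - M := sub_pos.mpr hMlt
      have hMl' : M * l / (μ * n) = 1 := by rw [hMl]; field_simp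
      have hml : m * l / (μ * n) = m / M := by rw [hl]; field_simp
      have hMμ : M * μ / (μ * n) = M / n := by field_simp
      have hmμ : m * μ / (μ * n) = m / n := by field_simp
      rw [hMl', hml, hMμ, hmμ, min_self, min_eq_left ((div_le_one hM).2 hmM),
        min_eq_left ((div_le_one hn).2 hMn), min_eq_left ((div_le_one hn).2 (hmM.trans hMn))]
      have hlsub : l - μ = μ * (n - M) / M := by rw [hl]; field_simp
      rw [hlsub]
      simp only [mul_zero, zero_div, min_eq_left zero_le_one]
      field_simp
      ring
end
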